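/- Let Γ be an inverse semigroup. Let A ⊆ Γ be directed, let x₁, …, xₙ ≺ x and y₁, …, y_m ≺ y in Γ, and assume: there is a ∈ A with a ≺ x; there is a ∈ A with a ≺ y; for every j ∈ {1,…,n} there is no a ∈ A with a ≺ x_j; and for every l ∈ {1,…,m} there is no a ∈ A with a ≺ y_l. Then there exist z ∈ Γ with z ≺ x and z ≺ y, and z₁, …, z_k ≺ z, such that: (i) there is a ∈ A with a ≺ z and for every i ∈ {1,…,k} there is no a ∈ A with a ≺ z_i; (ii) for every directed B ⊆ Γ such that some b ∈ B has b ≺ z and no b ∈ B has b ≺ z_i for any i, one has: some b ∈ B satisfies b ≺ x, some b ∈ B satisfies b ≺ y, no b ∈ B satisfies b ≺ x_j for any j, and no b ∈ B satisfies b ≺ y_l for any l. (This says the sets U_{x;x₁,…,xₙ} form a basis of a topology on the universal groupoid G_u(Γ).) -/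

import Mathlib

/-- An inverse semigroup: a semigroup in which every element `x` has a unique
element `x⁻¹` with `x * x⁻¹ * x = x` and `x⁻¹ * x * x⁻¹ = x⁻¹`. -/
class InverseSemigroup (α : Type*) extends Semigroup α, Inv α where
  mul_inv_mul : ∀ x : α, x * x⁻¹ * x = x
  inv_mul_inv : ∀ x : α, x⁻¹ * x * x⁻¹ = x⁻¹
  inv_unique : ∀ x y : α, x * y * x = x → y * x * y = y → y = x⁻¹

variable {α : Type*} [InverseSemigroup α]

/-- The natural order on an inverse semigroup: `x ≺ y` iff `x * y⁻¹ = x * x⁻¹`. -/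
def prec (x y : α) : Prop := x * y⁻¹ = x * x⁻¹

/-- The idempotents (units) `Γ⁽⁰⁾`: elements `p` with `p = p * p⁻¹`. -/
def IsIdem (p : α) : Prop := p = p * p⁻¹

/-- A zero element: `z * x = z = x * z` for every `x`. -/
def IsZeroEl (z : α) : Prop := ∀ x : α, z * x = z ∧ x * z = z


/-- A subset A is directed if any two of its elements have a common
precessor in A. -/
def IsDirectedSet (A : Set α) : Prop :=
  ∀ a ∈ A, ∀ b ∈ A, ∃ c ∈ A, prec c a ∧ prec c b

/-- Elementwise product of two subsets. -/
def mulSet (A B : Set α) : Set α := {x | ∃ a ∈ A, ∃ b ∈ B, x = a * b}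

/-- Elementwise inverse of a subset. -/
def invSet (A : Set α) : Set α := {x | ∃ a ∈ A, x = a⁻¹}

/-- A ≼ B iff every b ∈ B has some a ∈ A with a ≺ b. -/
def sprec (A B : Set α) : Prop := ∀ b ∈ B, ∃ a ∈ A, prec a b

/-- A ∼ B iff A ≼ B and B ≼ A. -/
def sequiv (A B : Set α) : Prop := sprec A B ∧ sprec B A


namespace InverseSemigroup

theorem inv_inv_eq (x : α) : x⁻¹⁻¹ = x :=
  (inv_unique x⁻¹ x (inv_mul_inv x) (mul_inv_mul x)).symm

theorem inv_eq_self_of_idem {e : α} (he : e * e = e) : e⁻¹ = e :=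
  (inv_unique e e (by rw [he, he]) (by rw [he, he])).symm

theorem mul_inv_idem (x : α) : x * x⁻¹ * (x * x⁻¹) = x * x⁻¹ := by
  rw [← mul_assoc, mul_inv_mul]

theorem inv_mul_idem (x : α) : x⁻¹ * x * (x⁻¹ * x) = x⁻¹ * x := by
  rw [← mul_assoc, inv_mul_inv]

theorem mul_idem_of_idem {e f : α} (he : e * e = e) (hf : f * f = f) :
    e * f * (e * f) = e * f := by
  have he' (t : α) : e * (e * t) = e * t := by rw [← mul_assoc, he]
  have hf' (t : α) : f * (f * t) = f * t := by rw [← mul_assoc, hf]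
  obtain ⟨x, hx⟩ : ∃ x, x = (e * f)⁻¹ := ⟨_, rfl⟩
  have h1 : e * (f * (x * (e * f))) = e * f := by
    have := mul_inv_mul (e * f)
    rwa [← hx, mul_assoc, mul_assoc] at this
  have h2 : x * (e * (f * x)) = x := by
    have := inv_mul_inv (e * f)
    rwa [← hx, mul_assoc, mul_assoc] at this
  have h2' (t : α) : x * (e * (f * (x * t))) = x * t := by
    have := congrArg (· * t) h2
    simpa only [mul_assoc] using this
  have h3 : f * (x * e) = x := by
    rw [hx]
    apply inv_unique
    · rw [← hx]
      simp only [mul_assoc, he', hf', h1]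
    · rw [← hx]
      simp only [mul_assoc, he', hf', h2']
  have h4 : x * x = x := by
    calc x * x = f * (x * e) * (f * (x * e)) := by rw [h3]
      _ = f * (x * e) := by simp only [mul_assoc, h2']
      _ = x := h3
  have h5 : e * f = x := by
    rw [← inv_inv_eq (e * f), ← hx, inv_eq_self_of_idem h4]
  rw [h5, h4]

theorem idem_comm {e f : α} (he : e * e = e) (hf : f * f = f) : e * f = f * e := by
  have he' (t : α) : e * (e * t) = e * t := by rw [← mul_assoc, he]
  have hf' (t : α) : f * (f * t) = f * t := by rw [← mul_assoc, hf]
  have hef := mul_idem_of_idem he hf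
  have hfe := mul_idem_of_idem hf he
  have h : f * e = (e * f)⁻¹ := by
    apply inv_unique
    · simpa only [mul_assoc, he', hf'] using hef
    · simpa only [mul_assoc, he', hf'] using hfe
  rw [h, inv_eq_self_of_idem hef]

theorem mul_inv_rev_eq (x y : α) : (x * y)⁻¹ = y⁻¹ * x⁻¹ := by
  have hc := idem_comm (mul_inv_idem y) (inv_mul_idem x)
  symm
  apply inv_unique
  · calc x * y * (y⁻¹ * x⁻¹) * (x * y) = x * (y * y⁻¹ * (x⁻¹ * x)) * y := by
          simp only [mul_assoc]
      _ = x * x⁻¹ * x * (y * y⁻¹ * y) := by rw [hc]; simp only [mul_assoc]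
      _ = x * y := by rw [mul_inv_mul, mul_inv_mul]
  · calc y⁻¹ * x⁻¹ * (x * y) * (y⁻¹ * x⁻¹) = y⁻¹ * (x⁻¹ * x * (y * y⁻¹)) * x⁻¹ := by
          simp only [mul_assoc]
      _ = y⁻¹ * y * y⁻¹ * (x⁻¹ * x * x⁻¹) := by rw [← hc]; simp only [mul_assoc]
      _ = y⁻¹ * x⁻¹ := by rw [inv_mul_inv, inv_mul_inv]

theorem prec_of_eq_idem_mul {x y e : α} (he : e * e = e) (h : x = e * y) : prec x y := by
  unfold prec
  rw [h, mul_inv_rev_eq, inv_eq_self_of_idem he]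
  calc e * y * y⁻¹ = e * e * (y * y⁻¹) := by rw [he, mul_assoc]
    _ = e * (y * y⁻¹ * e) := by rw [mul_assoc, idem_comm he (mul_inv_idem y)]
    _ = e * y * (y⁻¹ * e) := by simp only [mul_assoc]

theorem eq_mul_inv_mul_of_prec {x y : α} (h : prec x y) : x = x * x⁻¹ * y := by
  have h1 : y * x⁻¹ = x * x⁻¹ := by
    have := congrArg (·⁻¹) h
    simpa only [mul_inv_rev_eq, inv_inv_eq] using this
  have h2 : x = y * (x⁻¹ * x) := by rw [← mul_assoc, h1, mul_inv_mul]
  calc x = y * y⁻¹ * y * (x⁻¹ * x) := by rw [mul_inv_mul]; exact h2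
    _ = y * (x⁻¹ * x * (y⁻¹ * y)) := by
        rw [idem_comm (inv_mul_idem x) (inv_mul_idem y)]; simp only [mul_assoc]
    _ = y * x⁻¹ * (x * y⁻¹) * y := by simp only [mul_assoc]
    _ = x * x⁻¹ * y := by rw [h1, h, mul_inv_idem]

theorem prec_trans {x y z : α} (hxy : prec x y) (hyz : prec y z) : prec x z := by
  refine prec_of_eq_idem_mul (e := x * x⁻¹ * (y * y⁻¹))
    (mul_idem_of_idem (mul_inv_idem x) (mul_inv_idem y)) ?_
  rw [mul_assoc, ← eq_mul_inv_mul_of_prec hyz, ← eq_mul_inv_mul_of_prec hxy]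

theorem prec_refl (x : α) : prec x x := rfl

/-- If `c` and `u` have a common upper bound `x`, then `c * c⁻¹ * u` is below `c`. -/
theorem mul_inv_mul_prec_left {c u x : α} (hc : prec c x) (hu : prec u x) :
    prec (c * c⁻¹ * u) c := by
  refine prec_of_eq_idem_mul (mul_inv_idem u) ?_
  calc c * c⁻¹ * u = c * c⁻¹ * (u * u⁻¹ * x) := by rw [← eq_mul_inv_mul_of_prec hu]
    _ = u * u⁻¹ * (c * c⁻¹ * x) := by
        rw [← mul_assoc, idem_comm (mul_inv_idem c) (mul_inv_idem u), mul_assoc]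
    _ = u * u⁻¹ * c := by rw [← eq_mul_inv_mul_of_prec hc]

theorem mul_inv_mul_prec_right (c u : α) : prec (c * c⁻¹ * u) u :=
  prec_of_eq_idem_mul (mul_inv_idem c) rfl

theorem prec_mul_inv_mul {b c u : α} (hc : prec b c) (hu : prec b u) :
    prec b (c * c⁻¹ * u) := by
  refine prec_of_eq_idem_mul (mul_inv_idem b) ?_
  have h : b * b⁻¹ * (c * c⁻¹) = b * b⁻¹ := by
    calc b * b⁻¹ * (c * c⁻¹) = c * c⁻¹ * (b * b⁻¹) :=
          idem_comm (mul_inv_idem b) (mul_inv_idem c)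
      _ = c * c⁻¹ * (b * b⁻¹ * c * b⁻¹) := by rw [← eq_mul_inv_mul_of_prec hc]
      _ = c * c⁻¹ * (b * b⁻¹) * (c * b⁻¹) := by simp only [mul_assoc]
      _ = b * b⁻¹ * (c * c⁻¹ * c) * b⁻¹ := by
          rw [idem_comm (mul_inv_idem c) (mul_inv_idem b)]; simp only [mul_assoc]
      _ = b * b⁻¹ := by rw [mul_inv_mul, ← eq_mul_inv_mul_of_prec hc]
  rw [← mul_assoc, h, ← eq_mul_inv_mul_of_prec hu]

/-- A directed set with an element below `c` and one below `u` has an element below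
`c * c⁻¹ * u`. -/
theorem exists_prec_mul_inv_mul {B : Set α} (hB : IsDirectedSet B) {c u : α}
    (hc : ∃ b ∈ B, prec b c) (hu : ∃ b ∈ B, prec b u) :
    ∃ b ∈ B, prec b (c * c⁻¹ * u) := by
  obtain ⟨b₁, hb₁, h₁⟩ := hc
  obtain ⟨b₂, hb₂, h₂⟩ := hu
  obtain ⟨b, hb, hbb₁, hbb₂⟩ := hB b₁ hb₁ b₂ hb₂
  exact ⟨b, hb, prec_mul_inv_mul (prec_trans hbb₁ h₁) (prec_trans hbb₂ h₂)⟩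

end InverseSemigroup

/-- the sets U_{x;x₁,…,xₙ} form a basis of a topology: if the class
of the directed set A lies in U_{x;x₁,…,xₙ} ∩ U_{y;y₁,…,y_m}, then there are
z ≺ x, y and z₁,…,z_k ≺ z with [A] ∈ U_{z;z₁,…,z_k} ⊆ U_{x;x₁,…,xₙ} ∩ U_{y;y₁,…,y_m}. -/
theorem stmt9 (A : Set α) (hA : IsDirectedSet A)
    {n m : ℕ} (x y : α) (xs : Fin n → α) (ys : Fin m → α)
    (hxs : ∀ j, prec (xs j) x) (hys : ∀ l, prec (ys l) y)
    (hAx : ∃ a ∈ A, prec a x) (hAy : ∃ a ∈ A, prec a y)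
    (hAxs : ∀ j, ¬ ∃ a ∈ A, prec a (xs j))
    (hAys : ∀ l, ¬ ∃ a ∈ A, prec a (ys l)) :
    ∃ z : α, prec z x ∧ prec z y ∧
      ∃ (k : ℕ) (zs : Fin k → α),
        (∀ i, prec (zs i) z) ∧
        (∃ a ∈ A, prec a z) ∧
        (∀ i, ¬ ∃ a ∈ A, prec a (zs i)) ∧
        ∀ B : Set α, IsDirectedSet B →
          (∃ b ∈ B, prec b z) → (∀ i, ¬ ∃ b ∈ B, prec b (zs i)) →
          ((∃ b ∈ B, prec b x) ∧ (∃ b ∈ B, prec b y) ∧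
           (∀ j, ¬ ∃ b ∈ B, prec b (xs j)) ∧
           (∀ l, ¬ ∃ b ∈ B, prec b (ys l))) := by
  obtain ⟨a₁, ha₁, h₁⟩ := hAx
  obtain ⟨a₂, ha₂, h₂⟩ := hAy
  obtain ⟨c, hcA, hc₁, hc₂⟩ := hA a₁ ha₁ a₂ ha₂
  have hcx := InverseSemigroup.prec_trans hc₁ h₁
  have hcy := InverseSemigroup.prec_trans hc₂ h₂
  refine ⟨c, hcx, hcy, n + m, fun i => c * c⁻¹ * Fin.append xs ys i, ?_,
    ⟨c, hcA, InverseSemigroup.prec_refl c⟩, ?_, ?_⟩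
  · intro i
    refine Fin.addCases (fun j => ?_) (fun l => ?_) i
    · simpa only [Fin.append_left] using
        InverseSemigroup.mul_inv_mul_prec_left hcx (hxs j)
    · simpa only [Fin.append_right] using
        InverseSemigroup.mul_inv_mul_prec_left hcy (hys l)
  · rintro i ⟨a, ha, hai⟩
    have hau := InverseSemigroup.prec_trans hai
      (InverseSemigroup.mul_inv_mul_prec_right c (Fin.append xs ys i))
    revert hau
    refine Fin.addCases (fun j => ?_) (fun l => ?_) i
    · rw [Fin.append_left]
      exact fun h => hAxs j ⟨a, ha, h⟩
    · rw [Fin.append_right]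
      exact fun h => hAys l ⟨a, ha, h⟩
  · intro B hB hBc hBz
    obtain ⟨b, hb, hbc⟩ := hBc
    refine ⟨⟨b, hb, InverseSemigroup.prec_trans hbc hcx⟩,
      ⟨b, hb, InverseSemigroup.prec_trans hbc hcy⟩, fun j hj => ?_, fun l hl => ?_⟩
    · refine hBz (Fin.castAdd m j) ?_
      simpa only [Fin.append_left] using
        InverseSemigroup.exists_prec_mul_inv_mul hB ⟨b, hb, hbc⟩ hj
    · refine hBz (Fin.natAdd n l) ?_
      simpa only [Fin.append_right] using
        InverseSemigroup.exists_prec_mul_inv_mul hB ⟨b, hb, hbc⟩ hl
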